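/- Let n ≥ 1, let X ⊂ ℝⁿ be open and bounded, let Y ⊂ ℝⁿ be open, bounded and convex, let a₀ ∈ ℝ, y₀ ∈ Y, and let q > 1 and δ > 0. Let F¹ : X × ℝⁿ → ℝ be C² and F⁰ : X × ℝ → ℝ be C¹ satisfying: (H1) for every x ∈ X the map p ↦ F¹(x,p) is (q,δ)-strongly convex on Y; (H2) there is a locally bounded η : ℝ → ℝ with |∂_z F⁰(x,z)| ≤ η(z) for all x ∈ X, z ∈ ℝ; (H3) there is a locally bounded g on Y with |D_p F¹(x,p)| ≤ g(p) and |∂²F¹/∂x_i∂p_i(x,p)| ≤ g(p) for all x ∈ X, p ∈ Y, and every index i. Suppose u belongs to the admissible class U₀ and minimizes L(v) = ∫_X [ F¹(x,∇v(x)) + F⁰(x,v(x)) ] dx over U₀. Then for every compact subset X' ⊂ X there exist constants C > 0 and r₀ > 0 such that for every x₀ ∈ X', every y₀' ∈ ∂u(x₀), and every 0 < r < r₀, sup_{x ∈ B_r(x₀)} | u(x) − u(x₀) − y₀'·(x − x₀) | ≤ C r^{1 + 1/(q−1)} = C r^{q/(q−1)}. -/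

import Mathlib

open MeasureTheory RealInnerProductSpace Metric

/-- The subdifferential of `v` at `x`, relative to the set `X`. -/
def subgrad {n : ℕ} (X : Set (EuclideanSpace ℝ (Fin n)))
    (v : EuclideanSpace ℝ (Fin n) → ℝ) (x : EuclideanSpace ℝ (Fin n)) :
    Set (EuclideanSpace ℝ (Fin n)) :=
  {p | ∀ z ∈ X, v x + ⟪p, z - x⟫ ≤ v z}

/-- The admissible class `U₀`. -/
def admissible {n : ℕ} (X Y : Set (EuclideanSpace ℝ (Fin n))) (a₀ : ℝ)
    (y₀ : EuclideanSpace ℝ (Fin n)) (v : EuclideanSpace ℝ (Fin n) → ℝ) : Prop :=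
  ConvexOn ℝ X v ∧ (∀ x ∈ X, subgrad X v x ⊆ closure Y) ∧
    ∀ x ∈ X, a₀ + ⟪x, y₀⟫ ≤ v x

/-- The functional `L(v) = ∫_X [F¹(x, ∇v(x)) + F⁰(x, v(x))] dx`. -/
noncomputable def funcL {n : ℕ} (X : Set (EuclideanSpace ℝ (Fin n)))
    (F1 : EuclideanSpace ℝ (Fin n) → EuclideanSpace ℝ (Fin n) → ℝ)
    (F0 : EuclideanSpace ℝ (Fin n) → ℝ → ℝ)
    (v : EuclideanSpace ℝ (Fin n) → ℝ) : ℝ :=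
  ∫ x in X, (F1 x (gradient v x) + F0 x (v x))

section ConvexAnalysis

open Filter Topology Set
open scoped NNReal

variable {n : ℕ} {X Y : Set (EuclideanSpace ℝ (Fin n))} {v : EuclideanSpace ℝ (Fin n) → ℝ}
  {x : EuclideanSpace ℝ (Fin n)}

theorem subgrad_nonempty (hX : IsOpen X) (hv : ConvexOn ℝ X v) (hx : x ∈ X) :
    (subgrad X v x).Nonempty := by
  have hcont : ContinuousOn v X := hv.continuousOn hX
  have hopen : IsOpen {z : EuclideanSpace ℝ (Fin n) × ℝ | z.1 ∈ X ∧ v z.1 < z.2} := by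
    rw [isOpen_iff_mem_nhds]
    rintro ⟨z, s⟩ ⟨hz, hs⟩
    have h1 : ContinuousAt (fun z : EuclideanSpace ℝ (Fin n) × ℝ => v z.1) (z, s) :=
      ContinuousAt.comp (f := Prod.fst) (hcont.continuousAt (hX.mem_nhds hz)) continuousAt_fst
    filter_upwards [continuousAt_fst.preimage_mem_nhds (hX.mem_nhds hz),
      h1.eventually_lt continuousAt_snd hs] with a ha hb using ⟨ha, hb⟩
  obtain ⟨f, hf⟩ := geometric_hahn_banach_open_point hv.convex_strict_epigraph hopen
    (x := (x, v x)) (by simp)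
  have hsplit : ∀ z s, f (z, s) = f (z, 0) + s * f (0, 1) := by
    intro z s
    have : ((z, s) : EuclideanSpace ℝ (Fin n) × ℝ) = (z, 0) + s • (0, 1) := by simp
    rw [this, map_add, map_smul, smul_eq_mul]
  set c := f (0, 1) with hc
  have hcneg : c < 0 := by
    have := hf (x, v x + 1) ⟨hx, by simp⟩
    rw [hsplit, hsplit x (v x)] at this
    linarith
  have hle : ∀ z ∈ X, f (z, 0) + v z * c ≤ f (x, 0) + v x * c := by
    intro z hz
    refine le_of_forall_pos_le_add fun ε hε => ?_
    have hpos : 0 < ε / (-c) := div_pos hε (by linarith)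
    have := hf (z, v z + ε / (-c)) ⟨hz, by simpa using hpos⟩
    rw [hsplit, hsplit x (v x)] at this
    have h2 : ε / (-c) * c = -ε := by
      have := hcneg.ne
      field_simp
    nlinarith
  refine ⟨(InnerProductSpace.toDual ℝ _).symm
    ((-c)⁻¹ • f.comp (ContinuousLinearMap.inl ℝ _ ℝ)), fun z hz => ?_⟩
  have hd : f (z - x, 0) = f (z, 0) - f (x, 0) := by
    rw [← map_sub]; simp
  have := hle z hz
  simp only [InnerProductSpace.toDual_symm_apply, smul_apply,
    ContinuousLinearMap.comp_apply, ContinuousLinearMap.inl_apply, smul_eq_mul, hd]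
  have h3 : (-c)⁻¹ * (f (z, 0) - f (x, 0)) ≤ v z - v x := by
    rw [inv_mul_le_iff₀ (by linarith)]
    linarith
  linarith

theorem lipschitzOnWith_of_subgrad_subset {K : ℝ≥0} (hX : IsOpen X) (hv : ConvexOn ℝ X v)
    (hsub : ∀ x ∈ X, subgrad X v x ⊆ closure Y) (hK : ∀ y ∈ closure Y, ‖y‖ ≤ K) :
    LipschitzOnWith K v X := by
  refine LipschitzOnWith.of_le_add_mul K fun a ha b hb => ?_
  obtain ⟨p, hp⟩ := subgrad_nonempty hX hv ha
  have h1 := hp b hb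
  have h2 := (abs_le.1 (abs_real_inner_le_norm p (b - a))).1
  have h3 : ‖p‖ * ‖b - a‖ ≤ K * ‖b - a‖ := by
    gcongr; exact hK p (hsub a ha hp)
  rw [dist_eq_norm, norm_sub_rev]
  linarith

theorem gradient_mem_subgrad (hX : IsOpen X) (hv : ConvexOn ℝ X v) (hx : x ∈ X)
    (hd : DifferentiableAt ℝ v x) : gradient v x ∈ subgrad X v x := by
  obtain ⟨p, hp⟩ := subgrad_nonempty hX hv hx
  have hmin : IsLocalMin (fun z => v z - ⟪p, z⟫) x := by
    filter_upwards [hX.mem_nhds hx] with z hz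
    have := hp z hz
    rw [inner_sub_right] at this
    linarith
  have h1 : HasFDerivAt (fun z => v z - ⟪p, z⟫) (fderiv ℝ v x - innerSL ℝ p) x :=
    hd.hasFDerivAt.sub (innerSL ℝ p).hasFDerivAt
  have h2 := hmin.hasFDerivAt_eq_zero h1
  have h3 : gradient v x = p := by
    rw [gradient, sub_eq_zero.1 h2]
    exact (InnerProductSpace.toDual ℝ _).symm_apply_apply p
  rwa [h3]

theorem LipschitzOnWith.ae_differentiableAt_of_isOpen {K : ℝ≥0} (hX : IsOpen X)
    (hv : LipschitzOnWith K v X) : ∀ᵐ x ∂(volume.restrict X), DifferentiableAt ℝ v x := by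
  rw [ae_restrict_iff' hX.measurableSet]
  filter_upwards [hv.ae_differentiableWithinAt_of_mem (μ := volume)] with x hx hxX
  exact (hx hxX).differentiableAt (hX.mem_nhds hxX)

theorem subgrad_sup_affine_subset (hX : IsOpen X) (hYc : Convex ℝ Y) (hv : ConvexOn ℝ X v)
    (hsub : ∀ x ∈ X, subgrad X v x ⊆ closure Y) {p : EuclideanSpace ℝ (Fin n)}
    (hp : p ∈ closure Y) (b : ℝ) (hx : x ∈ X) :
    subgrad X (fun z => max (v z) (⟪p, z⟫ + b)) x ⊆ closure Y := by
  intro y hy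
  by_contra hyY
  obtain ⟨f, c, hf1, hf2⟩ := geometric_hahn_banach_closed_point hYc.closure isClosed_closure hyY
  set ω := (InnerProductSpace.toDual ℝ _).symm f with hω
  have hin : ∀ z, f z = ⟪z, ω⟫ := fun z => by
    rw [real_inner_comm, hω, InnerProductSpace.toDual_symm_apply]
  have hev : ∀ᶠ s : ℝ in 𝓝[>] 0, x + s • ω ∈ X := by
    have hc : ContinuousAt (fun s : ℝ => x + s • ω) 0 := by fun_prop
    exact nhdsWithin_le_nhds (hc.preimage_mem_nhds (by simpa using hX.mem_nhds hx))
  obtain ⟨s, hsX, hs⟩ := (hev.and self_mem_nhdsWithin).exists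
  have hs : 0 < s := hs
  have h1 := hy _ hsX
  simp only [add_sub_cancel_left, inner_smul_right] at h1
  rw [← hin] at h1
  obtain ⟨p', hp'⟩ := subgrad_nonempty hX hv hsX
  have h2 := hp' x hx
  have h3 := hf1 p' (hsub _ hsX hp')
  have h4 := hf1 p hp
  simp only [sub_add_cancel_left, inner_neg_right, inner_smul_right, ← hin] at h2
  have h5 : max (v (x + s • ω)) (⟪p, x + s • ω⟫ + b) ≤ max (v x) (⟪p, x⟫ + b) + s * c := by
    refine max_le ?_ ?_
    · have := le_max_left (v x) (⟪p, x⟫ + b)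
      nlinarith
    · have := le_max_right (v x) (⟪p, x⟫ + b)
      rw [inner_add_right, inner_smul_right, ← hin]
      nlinarith
  nlinarith

theorem admissible_sup_affine {a₀ : ℝ} {y₀ : EuclideanSpace ℝ (Fin n)} (hX : IsOpen X)
    (hYc : Convex ℝ Y) (hv : admissible X Y a₀ y₀ v) {p : EuclideanSpace ℝ (Fin n)}
    (hp : p ∈ closure Y) (b : ℝ) :
    admissible X Y a₀ y₀ (fun z => max (v z) (⟪p, z⟫ + b)) := by
  obtain ⟨h1, h2, h3⟩ := hv
  refine ⟨h1.sup ?_, fun x hx => subgrad_sup_affine_subset hX hYc h1 h2 hp b hx,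
    fun x hx => (h3 x hx).trans (le_max_left _ _)⟩
  exact ((innerSL ℝ p).toLinearMap.convexOn h1.1).add (convexOn_const b h1.1)

end ConvexAnalysis

section Transport

open Filter Topology Set
open scoped NNReal ENNReal

variable {n : ℕ} {X S : Set (EuclideanSpace ℝ (Fin n))}

theorem LipschitzOnWith.exists_norm_le {w : EuclideanSpace ℝ (Fin n) → ℝ} {K : ℝ≥0}
    (hw : LipschitzOnWith K w X) (hX : Bornology.IsBounded X) : ∃ A, ∀ x ∈ X, ‖w x‖ ≤ A := by
  obtain ⟨g, hg, hgw⟩ := hw.extend_real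
  obtain ⟨A, hA⟩ := (hg.isBounded_image hX).exists_norm_le
  exact ⟨A, fun x hx => by rw [hgw hx]; exact hA _ (mem_image_of_mem g hx)⟩

theorem setIntegral_comp_le_of_measure_image {T : EuclideanSpace ℝ (Fin n) → EuclideanSpace ℝ (Fin n)}
    {w : EuclideanSpace ℝ (Fin n) → ℝ} {m : ℝ} (hm : 0 < m) (hX : MeasurableSet X)
    (hS : MeasurableSet S) (hT : Measurable T) (hTS : MapsTo T S X)
    (himage : ∀ A ⊆ S, MeasurableSet A → ENNReal.ofReal m * volume A ≤ volume (T '' A))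
    (hw : ∀ x ∈ X, 0 ≤ w x) (hwint : IntegrableOn w X) :
    m * ∫ x in S, w (T x) ≤ ∫ x in X, w x := by
  have hmap : ENNReal.ofReal m • Measure.map T (volume.restrict S) ≤ volume.restrict X := by
    refine Measure.le_iff.2 fun B hB => ?_
    rw [Measure.smul_apply, Measure.map_apply hT hB, Measure.restrict_apply (hT hB),
      Measure.restrict_apply hB, smul_eq_mul]
    refine (himage _ inter_subset_right ((hT hB).inter hS)).trans (measure_mono ?_)
    rintro _ ⟨x, ⟨hxB, hxS⟩, rfl⟩
    exact ⟨hxB, hTS hxS⟩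
  have hwX : 0 ≤ᵐ[volume.restrict X] w := by
    filter_upwards [ae_restrict_mem hX] with x hx using hw x hx
  have hsm : AEStronglyMeasurable w (Measure.map T (volume.restrict S)) := by
    refine (hwint.aestronglyMeasurable.mono_measure hmap).mono_ac ?_
    exact Measure.absolutelyContinuous_smul (by simpa using hm)
  calc m * ∫ x in S, w (T x)
      = ∫ x, w x ∂(ENNReal.ofReal m • Measure.map T (volume.restrict S)) := by
        rw [integral_smul_measure, integral_map hT.aemeasurable hsm,
          ENNReal.toReal_ofReal hm.le, smul_eq_mul]
    _ ≤ ∫ x in X, w x := integral_mono_measure hmap hwX hwint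

theorem setIntegral_inner_gradient_add_le {w : EuclideanSpace ℝ (Fin n) → ℝ}
    {W : EuclideanSpace ℝ (Fin n) → EuclideanSpace ℝ (Fin n)} {K : ℝ≥0} {B m' : ℝ} {m : ℝ → ℝ}
    (hX : IsOpen X) (hXb : Bornology.IsBounded X) (hS : MeasurableSet S) (hSX : S ⊆ X)
    (hw : ∀ x ∈ X, 0 ≤ w x) (hwS : ∀ x ∈ X \ S, w x = 0) (hwK : LipschitzOnWith K w X)
    (hW : Continuous W) (hWB : ∀ x ∈ S, ‖W x‖ ≤ B) (hm0 : m 0 = 1) (hm : HasDerivAt m m' 0)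
    (hmaps : ∀ᶠ t : ℝ in 𝓝[>] 0, MapsTo (fun x => x + t • W x) S X)
    (himage : ∀ᶠ t : ℝ in 𝓝[>] 0, ∀ A ⊆ S, MeasurableSet A →
      ENNReal.ofReal (m t) * volume A ≤ volume ((fun x => x + t • W x) '' A)) :
    (∫ x in S, ⟪gradient w x, W x⟫) + m' * ∫ x in X, w x ≤ 0 := by
  have hXfin : volume X < ∞ := hXb.measure_lt_top
  have hSfin : volume S < ∞ := (measure_mono hSX).trans_lt hXfin
  have : IsFiniteMeasure (volume.restrict X) := ⟨by simpa using hXfin⟩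
  have : IsFiniteMeasure (volume.restrict S) := ⟨by simpa using hSfin⟩
  obtain ⟨A, hA⟩ : ∃ A, ∀ x ∈ X, ‖w x‖ ≤ A :=
    hwK.exists_norm_le hXb
  have hwintX : IntegrableOn w X := by
    refine Integrable.of_bound (hwK.continuousOn.aestronglyMeasurable hX.measurableSet) A ?_
    filter_upwards [ae_restrict_mem hX.measurableSet] with x hx using hA x hx
  have hcomp : ∀ t : ℝ, MapsTo (fun x => x + t • W x) S X →
      IntegrableOn (fun x => w (x + t • W x)) S := by
    intro t ht
    refine Integrable.of_bound ((hwK.continuousOn.comp (by fun_prop) ht).aestronglyMeasurable hS)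
      A ?_
    filter_upwards [ae_restrict_mem hS] with x hx using hA _ (ht hx)
  have hSX' : ∫ x in X, w x = ∫ x in S, w x :=
    setIntegral_eq_of_subset_of_forall_sdiff_eq_zero hX.measurableSet hSX hwS
  have hdiff : ∀ᵐ x ∂(volume.restrict S), DifferentiableAt ℝ w x :=
    ae_restrict_of_ae_restrict_of_subset hSX (hwK.ae_differentiableAt_of_isOpen hX)
  have hquot : Tendsto (fun t : ℝ => ∫ x in S, t⁻¹ * (w (x + t • W x) - w x)) (𝓝[>] 0)
      (𝓝 (∫ x in S, ⟪gradient w x, W x⟫)) := by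
    refine tendsto_integral_filter_of_dominated_convergence (fun _ => K * B) ?_ ?_
      (integrable_const _) ?_
    · filter_upwards [hmaps] with t ht
      exact (((hcomp t ht).sub (hwintX.mono_set hSX)).const_mul _).aestronglyMeasurable
    · filter_upwards [hmaps, self_mem_nhdsWithin] with t ht (htpos : 0 < t)
      filter_upwards [ae_restrict_mem hS] with x hx
      have h1 := hwK.norm_sub_le (ht hx) (hSX hx)
      simp only [add_sub_cancel_left, norm_smul, Real.norm_of_nonneg htpos.le] at h1
      rw [norm_mul, norm_inv, Real.norm_of_nonneg htpos.le, inv_mul_le_iff₀ htpos]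
      calc _ ≤ K * (t * ‖W x‖) := h1
        _ ≤ K * (t * B) := by gcongr; exact hWB x hx
        _ = t * (K * B) := by ring
    · filter_upwards [hdiff] with x hx
      have h1 := hx.hasFDerivAt.hasLineDerivAt (W x)
      have h2 := (hasDerivAt_iff_tendsto_slope_zero.1 h1)
      have h3 : fderiv ℝ w x (W x) = ⟪gradient w x, W x⟫ := by
        rw [gradient, InnerProductSpace.toDual_symm_apply]
      rw [h3] at h2
      refine (h2.mono_left (nhdsWithin_mono _ fun t (ht : 0 < t) => ht.ne')).congr fun t => ?_
      simp
  have hmder : Tendsto (fun t : ℝ => t⁻¹ * (m t - 1)) (𝓝[>] 0) (𝓝 m') := by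
    have h2 := (hasDerivAt_iff_tendsto_slope_zero.1 hm)
    refine (h2.mono_left (nhdsWithin_mono _ fun t (ht : 0 < t) => ht.ne')).congr fun t => ?_
    simp [hm0]
  have hm1 : Tendsto m (𝓝[>] 0) (𝓝 1) := by
    have := hm.continuousAt.tendsto
    rw [hm0] at this
    exact this.mono_left nhdsWithin_le_nhds
  have hlim := (hm1.mul hquot).add (hmder.mul_const (∫ x in X, w x))
  rw [one_mul] at hlim
  refine le_of_tendsto hlim ?_
  filter_upwards [hmaps, himage, self_mem_nhdsWithin, hm1.eventually (lt_mem_nhds one_pos)]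
    with t ht hti (htpos : 0 < t) hmt
  have h1 := setIntegral_comp_le_of_measure_image hmt hX.measurableSet hS
    (T := fun x => x + t • W x) (by fun_prop) ht hti hw hwintX
  rw [integral_const_mul, integral_sub (hcomp t ht) (hwintX.mono_set hSX), ← hSX']
  have h2 : m t * (t⁻¹ * ((∫ x in S, w (x + t • W x)) - ∫ x in X, w x)) +
      t⁻¹ * (m t - 1) * ∫ x in X, w x =
      t⁻¹ * (m t * (∫ x in S, w (x + t • W x)) - ∫ x in X, w x) := by ring
  rw [h2]
  exact mul_nonpos_of_nonneg_of_nonpos (inv_nonneg.2 htpos.le) (by linarith)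

theorem ofReal_pow_mul_volume_le_volume_image {T : EuclideanSpace ℝ (Fin n) → EuclideanSpace ℝ (Fin n)}
    {A : Set (EuclideanSpace ℝ (Fin n))} {c : ℝ} (hc : 0 < c)
    (hT : ∀ x ∈ A, ∀ y ∈ A, c * ‖x - y‖ ≤ ‖T x - T y‖) :
    ENNReal.ofReal (c ^ n) * volume A ≤ volume (T '' A) := by
  have hinj : InjOn T A := by
    intro x hx y hy hxy
    have := hT x hx y hy
    rw [hxy, sub_self, norm_zero] at this
    have h0 : ‖x - y‖ ≤ 0 := by
      by_contra! h
      nlinarith [mul_pos hc h]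
    exact sub_eq_zero.1 (norm_le_zero_iff.1 h0)
  set K : ℝ≥0 := ⟨c⁻¹, inv_nonneg.2 hc.le⟩ with hK
  have hlip : LipschitzOnWith K (Function.invFunOn T A) (T '' A) := by
    refine LipschitzOnWith.of_dist_le_mul ?_
    rintro _ ⟨x, hx, rfl⟩ _ ⟨y, hy, rfl⟩
    rw [hinj.leftInvOn_invFunOn hx, hinj.leftInvOn_invFunOn hy, dist_eq_norm, dist_eq_norm]
    change _ ≤ c⁻¹ * _
    rw [le_inv_mul_iff₀ hc]
    exact hT x hx y hy
  have himg : Function.invFunOn T A '' (T '' A) = A := hinj.invFunOn_image subset_rfl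
  have hH := hlip.hausdorffMeasure_image_le (d := (n : ℝ)) (Nat.cast_nonneg n)
  rw [himg] at hH
  have : (Measure.hausdorffMeasure (n : ℝ) : Measure (EuclideanSpace ℝ (Fin n))).IsAddHaarMeasure := by
    have := isAddHaarMeasure_hausdorffMeasure (E := EuclideanSpace ℝ (Fin n))
    rwa [finrank_euclideanSpace_fin] at this
  have hvol := Measure.isAddLeftInvariant_eq_smul (volume : Measure (EuclideanSpace ℝ (Fin n)))
    (Measure.hausdorffMeasure (n : ℝ))
  set k := Measure.addHaarScalarFactor (volume : Measure (EuclideanSpace ℝ (Fin n)))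
    (Measure.hausdorffMeasure (n : ℝ))
  have hvA : volume A ≤ (K : ℝ≥0∞) ^ n * volume (T '' A) := by
    rw [hvol, Measure.smul_apply, Measure.smul_apply, ENNReal.smul_def, ENNReal.smul_def, smul_eq_mul,
      smul_eq_mul]
    rw [ENNReal.rpow_natCast] at hH
    calc _ ≤ (k : ℝ≥0∞) * ((K : ℝ≥0∞) ^ n * Measure.hausdorffMeasure (n : ℝ) (T '' A)) := by gcongr
      _ = _ := by ring
  have hcK : ENNReal.ofReal (c ^ n) * (K : ℝ≥0∞) ^ n = 1 := by
    have : (K : ℝ≥0∞) = ENNReal.ofReal c⁻¹ := by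
      rw [ENNReal.ofReal, Real.toNNReal_of_nonneg (inv_nonneg.2 hc.le)]
      rfl
    rw [this, ← ENNReal.ofReal_pow (inv_nonneg.2 hc.le), ← ENNReal.ofReal_mul (by positivity),
      ← mul_pow, mul_inv_cancel₀ hc.ne', one_pow, ENNReal.ofReal_one]
  calc _ ≤ ENNReal.ofReal (c ^ n) * ((K : ℝ≥0∞) ^ n * volume (T '' A)) := by gcongr
    _ = volume (T '' A) := by rw [← mul_assoc, hcK, one_mul]

theorem det_smul_id_add_rankOne {e : EuclideanSpace ℝ (Fin n)} (he : ‖e‖ = 1) (s : ℝ) :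
    LinearMap.det (LinearMap.id + s • (innerₛₗ ℝ e).smulRight e :
      EuclideanSpace ℝ (Fin n) →ₗ[ℝ] EuclideanSpace ℝ (Fin n)) = 1 + s := by
  rw [← LinearMap.det_toMatrix (EuclideanSpace.basisFun (Fin n) ℝ).toBasis]
  have : LinearMap.toMatrix (EuclideanSpace.basisFun (Fin n) ℝ).toBasis
      (EuclideanSpace.basisFun (Fin n) ℝ).toBasis
      (LinearMap.id + s • (innerₛₗ ℝ e).smulRight e) =
      1 + Matrix.replicateCol Unit (s • e.ofLp) * Matrix.replicateRow Unit e.ofLp := by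
    ext i j
    simp [LinearMap.toMatrix_apply, Matrix.mul_apply, Matrix.one_apply, PiLp.single_apply,
      EuclideanSpace.inner_single_right]
    exact Or.inl (mul_comm _ _)
  rw [this, Matrix.det_one_add_replicateCol_mul_replicateRow, dotProduct_smul]
  have h2 : e.ofLp ⬝ᵥ e.ofLp = 1 := by
    have := EuclideanSpace.real_norm_sq_eq e
    rw [he] at this
    simp only [dotProduct, ← sq]
    linarith
  rw [h2]; simp

theorem LipschitzOnWith.norm_gradient_le {w : EuclideanSpace ℝ (Fin n) → ℝ} {K : ℝ≥0}
    (hX : IsOpen X) (hw : LipschitzOnWith K w X) {x : EuclideanSpace ℝ (Fin n)} (hx : x ∈ X) :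
    ‖gradient w x‖ ≤ K := by
  rw [gradient, LinearIsometryEquiv.norm_map]
  exact norm_fderiv_le_of_lipschitzOn ℝ (hX.mem_nhds hx) hw

theorem measurable_gradient (w : EuclideanSpace ℝ (Fin n) → ℝ) : Measurable (gradient w) :=
  (InnerProductSpace.toDual ℝ (EuclideanSpace ℝ (Fin n))).symm.continuous.measurable.comp
    (measurable_fderiv ℝ w)

theorem LipschitzOnWith.integrableOn {w : EuclideanSpace ℝ (Fin n) → ℝ} {K : ℝ≥0}
    (hX : IsOpen X) (hXb : Bornology.IsBounded X) (hw : LipschitzOnWith K w X) :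
    IntegrableOn w X := by
  have : IsFiniteMeasure (volume.restrict X) := ⟨by simpa using hXb.measure_lt_top⟩
  obtain ⟨A, hA⟩ := hw.exists_norm_le hXb
  refine Integrable.of_bound (hw.continuousOn.aestronglyMeasurable hX.measurableSet) A ?_
  filter_upwards [ae_restrict_mem hX.measurableSet] with x hx using hA x hx

theorem LipschitzOnWith.integrableOn_inner_gradient {w : EuclideanSpace ℝ (Fin n) → ℝ} {K : ℝ≥0}
    {V : EuclideanSpace ℝ (Fin n) → EuclideanSpace ℝ (Fin n)} {B : ℝ} (hX : IsOpen X)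
    (hXb : Bornology.IsBounded X) (hw : LipschitzOnWith K w X) (hV : Continuous V)
    (hVB : ∀ x ∈ X, ‖V x‖ ≤ B) : IntegrableOn (fun x => ⟪gradient w x, V x⟫) X := by
  have : IsFiniteMeasure (volume.restrict X) := ⟨by simpa using hXb.measure_lt_top⟩
  refine Integrable.of_bound
    ((measurable_gradient w).inner hV.measurable).aestronglyMeasurable (K * B) ?_
  filter_upwards [ae_restrict_mem hX.measurableSet] with x hx
  exact (norm_inner_le_norm _ _).trans
    (mul_le_mul (hw.norm_gradient_le hX hx) (hVB x hx) (norm_nonneg _) K.2)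

theorem eventually_pos_and_mul_lt_one (M : ℝ) : ∀ᶠ t : ℝ in 𝓝[>] 0, 0 < t ∧ t * M < 1 := by
  have h1 : ContinuousAt (fun t : ℝ => t * M) 0 := by fun_prop
  have h2 : ∀ᶠ t : ℝ in 𝓝 0, t * M < 1 := h1.eventually_lt continuousAt_const (by simp)
  filter_upwards [self_mem_nhdsWithin, nhdsWithin_le_nhds h2] with t ht htM using ⟨ht, htM⟩

theorem add_smul_sub_smul_mem {x₀ x v : EuclideanSpace ℝ (Fin n)} {d M t : ℝ} (hXc : Convex ℝ X)
    (hball : closedBall x₀ d ⊆ X) (hM : 0 ≤ M) (hv : ‖v‖ ≤ M * d) (hx : x ∈ X) (ht : 0 ≤ t)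
    (htM : t * M ≤ 1) : x + t • (v - M • (x - x₀)) ∈ X := by
  rcases hM.eq_or_lt with rfl | hM
  · have : v = 0 := norm_le_zero_iff.1 (by simpa using hv)
    simpa [this] using hx
  have hz : x₀ + M⁻¹ • v ∈ X := by
    refine hball ?_
    rw [mem_closedBall, dist_eq_norm, add_sub_cancel_left, norm_smul, norm_inv,
      Real.norm_of_nonneg hM.le, inv_mul_le_iff₀ hM]
    exact hv
  have := hXc hx hz (a := 1 - t * M) (b := t * M) (by linarith) (by positivity) (by ring)
  convert this using 1
  rw [smul_add, smul_smul, mul_assoc, mul_inv_cancel₀ hM.ne', mul_one]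
  module

theorem setIntegral_inner_gradient_le {w : EuclideanSpace ℝ (Fin n) → ℝ}
    {V : EuclideanSpace ℝ (Fin n) → EuclideanSpace ℝ (Fin n)} {x₀ : EuclideanSpace ℝ (Fin n)}
    {K Λ : ℝ≥0} {B d : ℝ} (hX : IsOpen X) (hXb : Bornology.IsBounded X) (hXc : Convex ℝ X)
    (hd : 0 < d) (hball : closedBall x₀ d ⊆ X) (hw : ∀ x ∈ X, 0 ≤ w x)
    (hwK : LipschitzOnWith K w X)
    (hrad : ∀ᵐ x ∂(volume.restrict X), ⟪gradient w x, x - x₀⟫ ≤ w x)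
    (hV : Continuous V) (hB : 0 ≤ B) (hVB : ∀ x ∈ X, ‖V x‖ ≤ B) (hVΛ : LipschitzOnWith Λ V X) :
    ∫ x in X, ⟪gradient w x, V x⟫ ≤ (n * (Λ + B / d) + B / d) * ∫ x in X, w x := by
  set M := B / d with hM
  have hM0 : 0 ≤ M := by positivity
  have hMd : M * d = B := by rw [hM]; field_simp
  obtain ⟨D, hD⟩ := hXb.exists_norm_le
  have hDx : ∀ x ∈ X, ‖x - x₀‖ ≤ D + ‖x₀‖ := fun x hx =>
    (norm_sub_le _ _).trans (by gcongr; exact hD x hx)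
  set W : EuclideanSpace ℝ (Fin n) → EuclideanSpace ℝ (Fin n) := fun x => V x - M • (x - x₀)
  set L : ℝ := Λ + M with hL
  have hL0 : 0 ≤ L := by positivity
  have hWL : ∀ x ∈ X, ∀ y ∈ X, ‖W x - W y‖ ≤ L * ‖x - y‖ := by
    intro x hx y hy
    have h1 : W x - W y = (V x - V y) - M • (x - y) := by simp only [W]; module
    rw [h1]
    refine (norm_sub_le _ _).trans ?_
    rw [norm_smul, Real.norm_of_nonneg hM0, hL, add_mul]
    gcongr
    exact hVΛ.norm_sub_le hx hy
  have hsmall : ∀ᶠ t : ℝ in 𝓝[>] 0, 0 < t ∧ t * M < 1 ∧ t * L < 1 := by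
    filter_upwards [eventually_pos_and_mul_lt_one M, eventually_pos_and_mul_lt_one L]
      with t h1 h2 using ⟨h1.1, h1.2, h2.2⟩
  have key := setIntegral_inner_gradient_add_le (S := X) (W := W) (w := w) (K := K)
    (B := B + M * (D + ‖x₀‖)) (m := fun t => (1 - t * L) ^ n) (m' := -(n * L))
    hX hXb hX.measurableSet subset_rfl hw (by simp) hwK (by fun_prop)
    (fun x hx => by
      refine (norm_sub_le _ _).trans ?_
      rw [norm_smul, Real.norm_of_nonneg hM0]
      gcongr
      · exact hVB x hx
      · exact hDx x hx)
    (by simp)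
    (by
      have h1 : HasDerivAt (fun t : ℝ => 1 - t * L) (-L) 0 := by
        simpa using ((hasDerivAt_id (0 : ℝ)).mul_const L).const_sub 1
      simpa using h1.fun_pow n)
    (by
      filter_upwards [hsmall] with t ⟨ht, htM, _⟩ x hx
      exact add_smul_sub_smul_mem hXc hball hM0 (by rw [hMd]; exact hVB x hx) hx ht.le htM.le)
    (by
      filter_upwards [hsmall] with t ⟨ht, _, htL⟩ A hA _
      refine ofReal_pow_mul_volume_le_volume_image (by linarith) fun x hx y hy => ?_
      have h1 := hWL x (hA hx) y (hA hy)
      have h2 : x + t • W x - (y + t • W y) = (x - y) - (-t) • (W x - W y) := by module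
      rw [h2]
      have h3 := norm_sub_norm_le (x - y) ((-t) • (W x - W y))
      rw [norm_smul, norm_neg, Real.norm_of_nonneg ht.le] at h3
      nlinarith [mul_le_mul_of_nonneg_left h1 ht.le])
  have hi1 : IntegrableOn (fun x => ⟪gradient w x, V x⟫) X :=
    hwK.integrableOn_inner_gradient hX hXb hV hVB
  have hi2 : IntegrableOn (fun x => ⟪gradient w x, x - x₀⟫) X :=
    hwK.integrableOn_inner_gradient hX hXb (by fun_prop) hDx
  have hsplit : ∫ x in X, ⟪gradient w x, W x⟫ =
      (∫ x in X, ⟪gradient w x, V x⟫) - M * ∫ x in X, ⟪gradient w x, x - x₀⟫ := by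
    rw [← integral_const_mul, ← integral_sub hi1 (hi2.const_mul M)]
    simp only [W, inner_sub_right, inner_smul_right]
  have hle : ∫ x in X, ⟪gradient w x, x - x₀⟫ ≤ ∫ x in X, w x :=
    integral_mono_ae hi2 (hwK.integrableOn hX hXb) hrad
  rw [hsplit] at key
  nlinarith [mul_le_mul_of_nonneg_left hle hM0]

theorem setIntegral_le_slab_mul_setIntegral_norm_gradient {w : EuclideanSpace ℝ (Fin n) → ℝ}
    {x₀ e : EuclideanSpace ℝ (Fin n)} {K : ℝ≥0} {ρ d : ℝ} (hX : IsOpen X)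
    (hXb : Bornology.IsBounded X) (hXc : Convex ℝ X) (hd : 0 < d) (hball : closedBall x₀ d ⊆ X)
    (hw : ∀ x ∈ X, 0 ≤ w x) (hwK : LipschitzOnWith K w X)
    (hrad : ∀ᵐ x ∂(volume.restrict X), ⟪gradient w x, x - x₀⟫ ≤ w x) (he : ‖e‖ = 1)
    (hρ : 0 ≤ ρ) (hS : MeasurableSet S) (hSX : S ⊆ X) (hwS : ∀ x ∈ X \ S, w x = 0)
    (hslab : ∀ x ∈ S, |⟪e, x - x₀⟫| ≤ ρ) :
    (1 - (n + 1) * (ρ / d)) * ∫ x in X, w x ≤ ρ * ∫ x in S, ‖gradient w x‖ := by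
  set M := ρ / d with hM
  have hM0 : 0 ≤ M := by positivity
  have hMd : M * d = ρ := by rw [hM]; field_simp
  obtain ⟨D, hD⟩ := hXb.exists_norm_le
  have hDx : ∀ x ∈ X, ‖x - x₀‖ ≤ D + ‖x₀‖ := fun x hx =>
    (norm_sub_le _ _).trans (by gcongr; exact hD x hx)
  have hVρ : ∀ x ∈ S, ‖⟪e, x - x₀⟫ • e‖ ≤ ρ := fun x hx => by
    rw [norm_smul, he, mul_one]; exact hslab x hx
  set W : EuclideanSpace ℝ (Fin n) → EuclideanSpace ℝ (Fin n) :=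
    fun x => ⟪e, x - x₀⟫ • e - M • (x - x₀)
  have key := setIntegral_inner_gradient_add_le (S := S) (W := W) (w := w) (K := K)
    (B := ρ + M * (D + ‖x₀‖)) (m := fun t => (1 - t * M) ^ n * (1 + t / (1 - t * M)))
    (m' := -(n * M) + 1)
    hX hXb hS hSX hw hwS hwK (by fun_prop)
    (fun x hx => by
      refine (norm_sub_le _ _).trans ?_
      rw [norm_smul M, Real.norm_of_nonneg hM0]
      gcongr
      · exact hVρ x hx
      · exact hDx x (hSX hx))
    (by simp)
    (by
      have h1 : HasDerivAt (fun t : ℝ => 1 - t * M) (-M) 0 := by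
        simpa using ((hasDerivAt_id (0 : ℝ)).mul_const M).const_sub 1
      have h2 : HasDerivAt (fun t : ℝ => 1 + t / (1 - t * M)) 1 0 := by
        simpa using ((hasDerivAt_id (0 : ℝ)).div h1 (by simp)).const_add 1
      simpa using (h1.fun_pow n).fun_mul h2)
    (by
      filter_upwards [eventually_pos_and_mul_lt_one M] with t ⟨ht, htM⟩ x hx
      exact add_smul_sub_smul_mem hXc hball hM0 (by rw [hMd]; exact hVρ x hx) (hSX hx) ht.le htM.le)
    (by
      filter_upwards [eventually_pos_and_mul_lt_one M] with t ⟨ht, htM⟩ A hA _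
      have hpos : 0 < 1 - t * M := by linarith
      set G : EuclideanSpace ℝ (Fin n) →ₗ[ℝ] EuclideanSpace ℝ (Fin n) :=
        (1 - t * M) • (LinearMap.id + (t / (1 - t * M)) • (innerₛₗ ℝ e).smulRight e) with hG
      have hT : (fun x => x + t • W x) '' A = (fun x => x₀ + x) '' (G '' ((fun x => -x₀ + x) '' A)) := by
        rw [image_image, image_image]
        refine image_congr fun x _ => ?_
        simp only [W, hG, LinearMap.smul_apply, LinearMap.add_apply, LinearMap.id_apply,
          LinearMap.smulRight_apply, innerₛₗ_apply_apply, smul_add, smul_smul,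
          mul_div_cancel₀ _ hpos.ne', ← sub_eq_neg_add]
        module
      have hdet : LinearMap.det G = (1 - t * M) ^ n * (1 + t / (1 - t * M)) := by
        rw [hG, LinearMap.det_smul, det_smul_id_add_rankOne he, finrank_euclideanSpace_fin]
      rw [hT, image_add_left, measure_preimage_add, Measure.addHaar_image_linearMap,
        image_add_left, measure_preimage_add, hdet, abs_of_pos (by positivity)])
  have hi1 : IntegrableOn (fun x => ⟪gradient w x, W x⟫) X :=
    hwK.integrableOn_inner_gradient (B := (D + ‖x₀‖) + M * (D + ‖x₀‖)) hX hXb (by fun_prop)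
      fun x hx => by
        refine (norm_sub_le _ _).trans ?_
        rw [norm_smul, norm_smul, he, mul_one, Real.norm_of_nonneg hM0]
        gcongr
        · refine (norm_inner_le_norm _ _).trans ?_
          rw [he, one_mul]
          exact hDx x hx
        · exact hDx x hx
  have hi2 : IntegrableOn (fun x => ‖gradient w x‖) X := by
    have : IsFiniteMeasure (volume.restrict X) := ⟨by simpa using hXb.measure_lt_top⟩
    refine Integrable.of_bound (measurable_gradient w).norm.aestronglyMeasurable K ?_
    filter_upwards [ae_restrict_mem hX.measurableSet] with x hx
    simpa using hwK.norm_gradient_le hX hx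
  have hiw := hwK.integrableOn hX hXb
  have hSX' : ∫ x in X, w x = ∫ x in S, w x :=
    setIntegral_eq_of_subset_of_forall_sdiff_eq_zero hX.measurableSet hSX hwS
  have hle : ∫ x in S, -⟪gradient w x, W x⟫ ≤ ∫ x in S, (ρ * ‖gradient w x‖ + M * w x) := by
    refine integral_mono_ae (hi1.mono_set hSX).neg
      (((hi2.mono_set hSX).const_mul ρ).add ((hiw.mono_set hSX).const_mul M)) ?_
    filter_upwards [ae_restrict_mem hS, ae_restrict_of_ae_restrict_of_subset hSX hrad] with x hx hr
    have h1 : -⟪gradient w x, ⟪e, x - x₀⟫ • e⟫ ≤ ρ * ‖gradient w x‖ := by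
      have h2 := (abs_le.1 (abs_real_inner_le_norm (gradient w x) (⟪e, x - x₀⟫ • e))).1
      nlinarith [mul_le_mul_of_nonneg_left (hVρ x hx) (norm_nonneg (gradient w x))]
    simp only [W, inner_sub_right (gradient w x) (_ • e), inner_smul_right _ _ M]
    nlinarith [mul_le_mul_of_nonneg_left hr hM0]
  rw [integral_neg, integral_add ((hi2.mono_set hSX).const_mul ρ) ((hiw.mono_set hSX).const_mul M),
    integral_const_mul, integral_const_mul, ← hSX'] at hle
  linarith

end Transport

section Height

open Filter Topology Set
open scoped NNReal ENNReal

variable {n : ℕ} {X S : Set (EuclideanSpace ℝ (Fin n))}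

theorem LipschitzOnWith.integrableOn_norm_gradient_rpow {w : EuclideanSpace ℝ (Fin n) → ℝ}
    {K : ℝ≥0} (hX : IsOpen X) (hXb : Bornology.IsBounded X) (hw : LipschitzOnWith K w X) {q : ℝ}
    (hq : 0 ≤ q) : IntegrableOn (fun x => ‖gradient w x‖ ^ q) X := by
  have : IsFiniteMeasure (volume.restrict X) := ⟨by simpa using hXb.measure_lt_top⟩
  refine Integrable.of_bound
    ((measurable_gradient w).norm.pow_const q).aestronglyMeasurable ((K : ℝ) ^ q) ?_
  filter_upwards [ae_restrict_mem hX.measurableSet] with x hx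
  rw [Real.norm_of_nonneg (by positivity)]
  exact Real.rpow_le_rpow (norm_nonneg _) (hw.norm_gradient_le hX hx) hq

theorem half_pow_mul_volume_le_setIntegral {w : EuclideanSpace ℝ (Fin n) → ℝ}
    {x₀ : EuclideanSpace ℝ (Fin n)} {K : ℝ≥0} {h : ℝ} (hX : IsOpen X)
    (hXb : Bornology.IsBounded X) (hXc : Convex ℝ X) (hx₀ : x₀ ∈ X) (hw : ∀ x ∈ X, 0 ≤ w x)
    (hwK : LipschitzOnWith K w X) (hS : MeasurableSet S) (hSX : S ⊆ X)
    (hmid : ∀ x ∈ S, h / 2 ≤ w ((1 / 2 : ℝ) • x₀ + (1 / 2 : ℝ) • x)) :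
    (1 / 2) ^ n * (h / 2 * volume.real S) ≤ ∫ x in X, w x := by
  have hSfin : volume S < ∞ := (measure_mono hSX).trans_lt hXb.measure_lt_top
  have : IsFiniteMeasure (volume.restrict S) := ⟨by simpa using hSfin⟩
  set T : EuclideanSpace ℝ (Fin n) → EuclideanSpace ℝ (Fin n) :=
    fun x => (1 / 2 : ℝ) • x₀ + (1 / 2 : ℝ) • x with hT
  have hmaps : MapsTo T S X := fun x hx =>
    hXc hx₀ (hSX hx) (by norm_num) (by norm_num) (by norm_num)
  have h1 := setIntegral_comp_le_of_measure_image (T := T) (w := w) (m := (1 / 2) ^ n)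
    (by positivity) hX.measurableSet hS (by fun_prop) hmaps
    (fun A _ _ => ofReal_pow_mul_volume_le_volume_image (by norm_num) fun x _ y _ => by
      have : T x - T y = (1 / 2 : ℝ) • (x - y) := by simp only [hT]; module
      rw [this, norm_smul, Real.norm_of_nonneg (by norm_num)]) hw (hwK.integrableOn hX hXb)
  refine le_trans ?_ h1
  gcongr
  obtain ⟨A, hA⟩ := hwK.exists_norm_le hXb
  have hwint : IntegrableOn (fun x => w (T x)) S := by
    refine Integrable.of_bound
      ((hwK.continuousOn.comp (by fun_prop) hmaps).aestronglyMeasurable hS) A ?_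
    filter_upwards [ae_restrict_mem hS] with x hx using hA _ (hmaps hx)
  have h2 : ∫ _ in S, h / 2 ≤ ∫ x in S, w (T x) :=
    setIntegral_mono_on (integrable_const _) hwint hS hmid
  rw [setIntegral_const, smul_eq_mul] at h2
  linarith

theorem le_add_rpow_one_sub_mul_rpow {a β q : ℝ} (ha : 0 ≤ a) (hβ : 0 < β) (hq : 1 < q) :
    a ≤ β + β ^ (1 - q) * a ^ q := by
  rcases le_total a β with h | h
  · have : 0 ≤ β ^ (1 - q) * a ^ q := by positivity
    linarith
  · have ha' : 0 < a := hβ.trans_le h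
    have h1 : a ^ (1 - q) ≤ β ^ (1 - q) := Real.rpow_le_rpow_of_nonpos hβ h (by linarith)
    have h2 : a ^ (1 - q) * a ^ q = a := by
      rw [← Real.rpow_add ha']; simp
    nlinarith [mul_le_mul_of_nonneg_right h1 (Real.rpow_nonneg ha q)]

theorem height_le_of_energy_le {w : EuclideanSpace ℝ (Fin n) → ℝ}
    {x₀ e : EuclideanSpace ℝ (Fin n)} {K : ℝ≥0} {r d q C h : ℝ} (hX : IsOpen X)
    (hXb : Bornology.IsBounded X) (hXc : Convex ℝ X) (hd : 0 < d) (hball : closedBall x₀ d ⊆ X)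
    (hw : ∀ x ∈ X, 0 ≤ w x) (hwK : LipschitzOnWith K w X)
    (hrad : ∀ᵐ x ∂(volume.restrict X), ⟪gradient w x, x - x₀⟫ ≤ w x) (he : ‖e‖ = 1)
    (hr : 0 < r) (hrd : 4 * (n + 1) * r ≤ d) (hS : MeasurableSet S) (hSX : S ⊆ X)
    (hSpos : 0 < volume.real S) (hwS : ∀ x ∈ X \ S, w x = 0)
    (hslab : ∀ x ∈ S, |⟪e, x - x₀⟫| ≤ 2 * r) (hq : 1 < q) (hC : 0 < C)
    (henergy : ∫ x in X, ‖gradient w x‖ ^ q ≤ C * ∫ x in X, w x)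
    (hmid : ∀ x ∈ S, h / 2 ≤ w ((1 / 2 : ℝ) • x₀ + (1 / 2 : ℝ) • x)) :
    h ≤ 16 * 2 ^ n * (8 * C) ^ (1 / (q - 1)) * r ^ (q / (q - 1)) := by
  have hx₀ : x₀ ∈ X := hball (mem_closedBall_self hd.le)
  have hSfin : volume S < ∞ := (measure_mono hSX).trans_lt hXb.measure_lt_top
  have : IsFiniteMeasure (volume.restrict S) := ⟨by simpa using hSfin⟩
  have hlow := half_pow_mul_volume_le_setIntegral hX hXb hXc hx₀ hw hwK hS hSX hmid
  have hslab' := setIntegral_le_slab_mul_setIntegral_norm_gradient hX hXb hXc hd hball hw hwK hrad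
    he (by positivity : 0 ≤ 2 * r) hS hSX hwS hslab
  set I := ∫ x in X, w x
  have hI : 0 ≤ I := setIntegral_nonneg hX.measurableSet hw
  have hq1 : 0 < q - 1 := by linarith
  set β := (8 * r * C) ^ (1 / (q - 1)) with hβ
  have hβpos : 0 < β := by positivity
  have hβq : β ^ (1 - q) = (8 * r * C)⁻¹ := by
    rw [hβ, ← Real.rpow_mul (by positivity), show 1 / (q - 1) * (1 - q) = -1 by field_simp; ring,
      Real.rpow_neg_one]
  have hwint := hwK.integrableOn_norm_gradient_rpow hX hXb (by linarith : 0 ≤ q)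
  have hJ : ∫ x in S, ‖gradient w x‖ ≤ β * volume.real S + (8 * r * C)⁻¹ * (C * I) := by
    have hi1 : IntegrableOn (fun x => ‖gradient w x‖) S := by
      simpa using (hwK.integrableOn_norm_gradient_rpow hX hXb zero_le_one).mono_set hSX
    calc ∫ x in S, ‖gradient w x‖
        ≤ ∫ x in S, (β + β ^ (1 - q) * ‖gradient w x‖ ^ q) :=
          integral_mono hi1 ((integrable_const β).add ((hwint.mono_set hSX).const_mul _))
            fun x => le_add_rpow_one_sub_mul_rpow (norm_nonneg _) hβpos hq
      _ = β * volume.real S + β ^ (1 - q) * ∫ x in S, ‖gradient w x‖ ^ q := by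
          rw [integral_add (integrable_const β) ((hwint.mono_set hSX).const_mul _),
            integral_const_mul, setIntegral_const, smul_eq_mul, mul_comm β]
      _ ≤ β * volume.real S + (8 * r * C)⁻¹ * (C * I) := by
          rw [hβq]
          gcongr
          refine (setIntegral_mono_set hwint ?_ hSX.eventuallyLE).trans henergy
          exact Eventually.of_forall fun x => by positivity
  have hhalf : 1 / 2 * I ≤ (1 - (n + 1) * (2 * r / d)) * I := by
    gcongr
    have : (n + 1) * (2 * r / d) ≤ (1 / 2 : ℝ) := by
      rw [← mul_div_assoc, div_le_iff₀ hd]; linarith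
    linarith
  have hcancel : (8 * r * C)⁻¹ * (C * I) = I / (8 * r) := by field_simp
  rw [hcancel] at hJ
  have hup : I ≤ 8 * r * (β * volume.real S) := by
    have h1 := mul_le_mul_of_nonneg_left hJ (by positivity : 0 ≤ 2 * r)
    have h2 : 2 * r * (I / (8 * r)) = I / 4 := by field_simp; ring
    nlinarith
  have hfin : (1 / 2) ^ n * (h / 2) ≤ 8 * r * β := by
    refine le_of_mul_le_mul_right ?_ hSpos
    linarith
  have hpow : r * β = (8 * C) ^ (1 / (q - 1)) * r ^ (q / (q - 1)) := by
    rw [hβ, show 8 * r * C = 8 * C * r by ring, Real.mul_rpow (by positivity) hr.le,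
      show q / (q - 1) = 1 / (q - 1) + 1 by field_simp; ring, Real.rpow_add_one hr.ne']
    ring
  have h2n : (2 : ℝ) ^ n * (1 / 2) ^ n = 1 := by rw [← mul_pow]; norm_num
  calc h = 2 * ((2 : ℝ) ^ n * (1 / 2) ^ n) * (h / 2) := by rw [h2n]; ring
    _ = 2 * 2 ^ n * ((1 / 2) ^ n * (h / 2)) := by ring
    _ ≤ 2 * 2 ^ n * (8 * r * β) := by gcongr
    _ = 16 * 2 ^ n * (r * β) := by ring
    _ = _ := by rw [hpow]; ring

end Height

section Energy

open Filter Topology Set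
open scoped NNReal ENNReal

variable {n : ℕ} {X Y : Set (EuclideanSpace ℝ (Fin n))} {u : EuclideanSpace ℝ (Fin n) → ℝ}
  {F1 : EuclideanSpace ℝ (Fin n) → EuclideanSpace ℝ (Fin n) → ℝ}
  {F0 : EuclideanSpace ℝ (Fin n) → ℝ → ℝ}

theorem contDiff_gradient_uncurry
    (hF1 : ContDiff ℝ 2 (fun z : EuclideanSpace ℝ (Fin n) × EuclideanSpace ℝ (Fin n) =>
      F1 z.1 z.2)) :
    ContDiff ℝ 1 (fun z : EuclideanSpace ℝ (Fin n) × EuclideanSpace ℝ (Fin n) =>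
      gradient (F1 z.1) z.2) := by
  refine (InnerProductSpace.toDual ℝ (EuclideanSpace ℝ (Fin n))).symm.contDiff.comp ?_
  refine ContDiff.fderiv (m := 2) ?_ contDiff_snd (by norm_num)
  exact hF1.comp ((contDiff_fst.comp contDiff_fst).prodMk contDiff_snd)

theorem strongConvex_closure {q δ : ℝ} (hq : 0 < q) {f : EuclideanSpace ℝ (Fin n) → ℝ}
    (hf : Continuous f) (hf' : Continuous (gradient f))
    (H : ∀ p₁ ∈ Y, ∀ p₂ ∈ Y, f p₁ - f p₂ ≥ ⟪gradient f p₂, p₁ - p₂⟫ + δ * ‖p₁ - p₂‖ ^ q) :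
    ∀ p₁ ∈ closure Y, ∀ p₂ ∈ closure Y,
      ⟪gradient f p₂, p₁ - p₂⟫ + δ * ‖p₁ - p₂‖ ^ q ≤ f p₁ - f p₂ := by
  intro p₁ hp₁ p₂ hp₂
  have hpow : Continuous fun z : EuclideanSpace ℝ (Fin n) × EuclideanSpace ℝ (Fin n) =>
      ‖z.1 - z.2‖ ^ q :=
    (continuous_fst.sub continuous_snd).norm.rpow_const fun _ => Or.inr hq.le
  have hclosed : IsClosed {z : EuclideanSpace ℝ (Fin n) × EuclideanSpace ℝ (Fin n) |
      ⟪gradient f z.2, z.1 - z.2⟫ + δ * ‖z.1 - z.2‖ ^ q ≤ f z.1 - f z.2} :=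
    isClosed_le (((hf'.comp continuous_snd).inner (continuous_fst.sub continuous_snd)).add
      (hpow.const_mul δ)) (by fun_prop)
  have hmem : (p₁, p₂) ∈ closure (Y ×ˢ Y) := by
    rw [closure_prod_eq]; exact ⟨hp₁, hp₂⟩
  exact closure_minimal (fun z hz => H z.1 hz.1 z.2 hz.2) hclosed hmem

theorem gradient_sup_affine_sub {p x : EuclideanSpace ℝ (Fin n)} {b : ℝ}
    (hu : DifferentiableAt ℝ u x) (hv : DifferentiableAt ℝ (fun z => max (u z) (⟪p, z⟫ + b)) x) :
    (⟪p, x⟫ + b ≤ u x ∧ gradient (fun z => max (u z) (⟪p, z⟫ + b) - u z) x = 0 ∧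
      gradient (fun z => max (u z) (⟪p, z⟫ + b)) x = gradient u x) ∨
    (u x < ⟪p, x⟫ + b ∧
      gradient (fun z => max (u z) (⟪p, z⟫ + b) - u z) x = p - gradient u x ∧
      gradient (fun z => max (u z) (⟪p, z⟫ + b)) x = p) := by
  have hsub : gradient (fun z => max (u z) (⟪p, z⟫ + b) - u z) x =
      gradient (fun z => max (u z) (⟪p, z⟫ + b)) x - gradient u x := by
    simp only [gradient]
    rw [fderiv_fun_sub hv hu, map_sub]
  rcases le_or_gt (⟪p, x⟫ + b) (u x) with h | h
  · left
    have hmin : IsLocalMin (fun z => max (u z) (⟪p, z⟫ + b) - u z) x := by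
      refine Eventually.of_forall fun z => ?_
      simp [max_eq_left h]
    have h0 : gradient (fun z => max (u z) (⟪p, z⟫ + b) - u z) x = 0 := by
      rw [gradient, hmin.fderiv_eq_zero, map_zero]
    exact ⟨h, h0, sub_eq_zero.1 (hsub ▸ h0)⟩
  · right
    have hev : (fun z => max (u z) (⟪p, z⟫ + b)) =ᶠ[𝓝 x] fun z => ⟪p, z⟫ + b := by
      have hc : ContinuousAt (fun z => ⟪p, z⟫ + b) x := by fun_prop
      filter_upwards [hu.continuousAt.eventually_lt hc h] with z hz using max_eq_right hz.le
    have hgrad : HasGradientAt (fun z => ⟪p, z⟫ + b) p x := by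
      rw [hasGradientAt_iff_hasFDerivAt]
      exact ((innerSL ℝ p).hasFDerivAt).add_const b
    have hp : gradient (fun z => max (u z) (⟪p, z⟫ + b)) x = p :=
      (hgrad.congr_of_eventuallyEq hev).gradient
    exact ⟨h, by rw [hsub, hp], hp⟩

theorem integrableOn_lagrangian {K : ℝ≥0} (hX : IsOpen X) (hXb : Bornology.IsBounded X)
    (hF1 : Continuous (fun z : EuclideanSpace ℝ (Fin n) × EuclideanSpace ℝ (Fin n) => F1 z.1 z.2))
    (hF0 : Continuous (fun z : EuclideanSpace ℝ (Fin n) × ℝ => F0 z.1 z.2))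
    (hu : LipschitzOnWith K u X) :
    IntegrableOn (fun x => F1 x (gradient u x) + F0 x (u x)) X := by
  have : IsFiniteMeasure (volume.restrict X) := ⟨by simpa using hXb.measure_lt_top⟩
  have hXcpt : IsCompact (closure X) := hXb.isCompact_closure
  obtain ⟨A, hA⟩ := hu.exists_norm_le hXb
  obtain ⟨B₁, hB₁⟩ := (hXcpt.prod (isCompact_closedBall (0 : EuclideanSpace ℝ (Fin n))
    K)).exists_bound_of_continuousOn hF1.continuousOn
  obtain ⟨B₀, hB₀⟩ := (hXcpt.prod (isCompact_closedBall (0 : ℝ)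
    A)).exists_bound_of_continuousOn hF0.continuousOn
  refine Integrable.add (Integrable.of_bound (C := B₁) ?_ ?_) (Integrable.of_bound (C := B₀) ?_ ?_)
  · exact (hF1.measurable.comp
      (measurable_id.prodMk (measurable_gradient u))).aestronglyMeasurable
  · filter_upwards [ae_restrict_mem hX.measurableSet] with x hx
    exact hB₁ (x, gradient u x)
      ⟨subset_closure hx, by simpa using hu.norm_gradient_le hX hx⟩
  · exact (hF0.comp_continuousOn
      (continuousOn_id.prodMk hu.continuousOn)).aestronglyMeasurable hX.measurableSet
  · filter_upwards [ae_restrict_mem hX.measurableSet] with x hx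
    exact hB₀ (x, u x) ⟨subset_closure hx, by simpa using hA x hx⟩

theorem energy_le_of_minimizer {a₀ q δ C₀ B b : ℝ} {y₀ p : EuclideanSpace ℝ (Fin n)} {K : ℝ≥0}
    (hX : IsOpen X) (hXb : Bornology.IsBounded X) (hYc : Convex ℝ Y)
    (hK : ∀ y ∈ closure Y, ‖y‖ ≤ K) (hq : 0 < q)
    (hF1 : ContDiff ℝ 2 (fun z : EuclideanSpace ℝ (Fin n) × EuclideanSpace ℝ (Fin n) =>
      F1 z.1 z.2))
    (hF0 : Continuous (fun z : EuclideanSpace ℝ (Fin n) × ℝ => F0 z.1 z.2))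
    (H1 : ∀ x ∈ X, ∀ p₁ ∈ Y, ∀ p₂ ∈ Y,
      F1 x p₁ - F1 x p₂ ≥ ⟪gradient (F1 x) p₂, p₁ - p₂⟫ + δ * ‖p₁ - p₂‖ ^ q)
    (hu : admissible X Y a₀ y₀ u)
    (hmin : ∀ v, admissible X Y a₀ y₀ v → funcL X F1 F0 u ≤ funcL X F1 F0 v)
    (hp : p ∈ closure Y) (hB : ∀ x ∈ X, ‖gradient (F1 x) p‖ ≤ B)
    (hC₀ : ∀ x ∈ X, F0 x (max (u x) (⟪p, x⟫ + b)) - F0 x (u x) ≤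
      C₀ * (max (u x) (⟪p, x⟫ + b) - u x)) :
    δ * ∫ x in X, ‖gradient (fun z => max (u z) (⟪p, z⟫ + b) - u z) x‖ ^ q ≤
      (∫ x in X, ⟪gradient (fun z => max (u z) (⟪p, z⟫ + b) - u z) x, gradient (F1 x) p⟫) +
        C₀ * ∫ x in X, (max (u x) (⟪p, x⟫ + b) - u x) := by
  have hv := admissible_sup_affine hX hYc hu hp b
  have huK := lipschitzOnWith_of_subgrad_subset hX hu.1 hu.2.1 hK
  have hvK := lipschitzOnWith_of_subgrad_subset hX hv.1 hv.2.1 hK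
  have hwK := hvK.sub huK
  have hle := hmin _ hv
  set v : EuclideanSpace ℝ (Fin n) → ℝ := fun z => max (u z) (⟪p, z⟫ + b) with hvdef
  set w : EuclideanSpace ℝ (Fin n) → ℝ := fun z => max (u z) (⟪p, z⟫ + b) - u z with hwdef
  change LipschitzOnWith _ w X at hwK
  change δ * _ ≤ _ + C₀ * ∫ x in X, w x
  have hgrad := (contDiff_gradient_uncurry hF1).continuous
  have hVc : Continuous fun x => gradient (F1 x) p :=
    hgrad.comp (continuous_id.prodMk continuous_const)
  have hi1 := hwK.integrableOn_inner_gradient hX hXb hVc hB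
  have hi2 := hwK.integrableOn_norm_gradient_rpow hX hXb hq.le
  have hi3 := hwK.integrableOn hX hXb
  have hiu := integrableOn_lagrangian hX hXb hF1.continuous hF0 huK
  have hiv := integrableOn_lagrangian hX hXb hF1.continuous hF0 hvK
  have hpt : ∀ᵐ x ∂(volume.restrict X),
      (F1 x (gradient v x) + F0 x (v x)) - (F1 x (gradient u x) + F0 x (u x)) ≤
        (⟪gradient w x, gradient (F1 x) p⟫ - δ * ‖gradient w x‖ ^ q) + C₀ * w x := by
    filter_upwards [huK.ae_differentiableAt_of_isOpen hX, hvK.ae_differentiableAt_of_isOpen hX,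
      ae_restrict_mem hX.measurableSet] with x hux hvx hx
    have hF0x : F0 x (v x) - F0 x (u x) ≤ C₀ * w x := hC₀ x hx
    rcases gradient_sup_affine_sub hux hvx with ⟨-, h1, h2⟩ | ⟨-, h1, h2⟩
    · rw [h1, h2, inner_zero_left, norm_zero, Real.zero_rpow hq.ne']
      linarith
    · rw [h1, h2]
      have h3 := strongConvex_closure hq (hF1.continuous.comp (continuous_const.prodMk continuous_id))
        (hgrad.comp (continuous_const.prodMk continuous_id)) (H1 x hx) (gradient u x)
        (hu.2.1 x hx (gradient_mem_subgrad hX hu.1 hx hux)) p hp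
      rw [norm_sub_rev, real_inner_comm, ← neg_sub p, inner_neg_left] at h3
      simp only [Function.comp_apply, id] at h3
      change -⟪p - gradient u x, gradient (F1 x) p⟫ + _ ≤ _ at h3
      linarith
  have hi12 : IntegrableOn (fun x => ⟪gradient w x, gradient (F1 x) p⟫ - δ * ‖gradient w x‖ ^ q) X :=
    hi1.sub (hi2.const_mul δ)
  have hsplit : ∫ x in X, ((⟪gradient w x, gradient (F1 x) p⟫ - δ * ‖gradient w x‖ ^ q) +
      C₀ * w x) = (∫ x in X, ⟪gradient w x, gradient (F1 x) p⟫) -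
        (δ * ∫ x in X, ‖gradient w x‖ ^ q) + C₀ * ∫ x in X, w x := by
    rw [integral_add hi12 (hi3.const_mul C₀), integral_sub hi1 (hi2.const_mul δ),
      integral_const_mul, integral_const_mul]
  have hwint := integral_mono_ae (hiv.sub hiu) (hi12.add (hi3.const_mul C₀)) hpt
  simp only [Pi.sub_apply, Pi.add_apply] at hwint
  rw [integral_sub hiv hiu, hsplit] at hwint
  simp only [funcL] at hle
  linarith

theorem ae_inner_gradient_sup_affine_sub_le {K K' : ℝ≥0} {p x₀ : EuclideanSpace ℝ (Fin n)} {b : ℝ}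
    (hX : IsOpen X) (hu : ConvexOn ℝ X u) (huK : LipschitzOnWith K u X)
    (hvK : LipschitzOnWith K' (fun z => max (u z) (⟪p, z⟫ + b)) X) (hx₀ : x₀ ∈ X)
    (hb : u x₀ ≤ ⟪p, x₀⟫ + b) :
    ∀ᵐ x ∂(volume.restrict X),
      ⟪gradient (fun z => max (u z) (⟪p, z⟫ + b) - u z) x, x - x₀⟫ ≤
        max (u x) (⟪p, x⟫ + b) - u x := by
  filter_upwards [huK.ae_differentiableAt_of_isOpen hX, hvK.ae_differentiableAt_of_isOpen hX,
    ae_restrict_mem hX.measurableSet] with x hux hvx hx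
  rcases gradient_sup_affine_sub hux hvx with ⟨-, h1, -⟩ | ⟨h, h1, -⟩
  · rw [h1, inner_zero_left]
    linarith [le_max_left (u x) (⟪p, x⟫ + b)]
  · rw [h1, max_eq_right h.le]
    have h2 := gradient_mem_subgrad hX hu hx hux x₀ hx₀
    rw [inner_sub_right] at h2
    rw [inner_sub_left, inner_sub_right, inner_sub_right]
    linarith

theorem separation_le_of_energy_constants {a₀ q δ C₀ B D A d r : ℝ}
    {y₀ x₀ x y' : EuclideanSpace ℝ (Fin n)} {K Λ : ℝ≥0}
    (hX : IsOpen X) (hXb : Bornology.IsBounded X) (hYc : Convex ℝ Y)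
    (hK : ∀ y ∈ closure Y, ‖y‖ ≤ K) (hD : ∀ z ∈ X, ‖z‖ ≤ D) (hA : ∀ z ∈ X, |u z| ≤ A)
    (hq : 1 < q) (hδ : 0 < δ)
    (hF1 : ContDiff ℝ 2 (fun z : EuclideanSpace ℝ (Fin n) × EuclideanSpace ℝ (Fin n) =>
      F1 z.1 z.2))
    (hF0 : Continuous (fun z : EuclideanSpace ℝ (Fin n) × ℝ => F0 z.1 z.2))
    (H1 : ∀ x ∈ X, ∀ p₁ ∈ Y, ∀ p₂ ∈ Y,
      F1 x p₁ - F1 x p₂ ≥ ⟪gradient (F1 x) p₂, p₁ - p₂⟫ + δ * ‖p₁ - p₂‖ ^ q)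
    (hu : admissible X Y a₀ y₀ u)
    (hmin : ∀ v, admissible X Y a₀ y₀ v → funcL X F1 F0 u ≤ funcL X F1 F0 v)
    (hB : 0 ≤ B) (hVB : ∀ z ∈ X, ∀ p ∈ closure Y, ‖gradient (F1 z) p‖ ≤ B)
    (hVΛ : ∀ p ∈ closure Y, LipschitzOnWith Λ (fun z => gradient (F1 z) p) X)
    (hC₀ : 0 ≤ C₀) (hF0C : ∀ z ∈ X, ∀ s t : ℝ, |s| ≤ 3 * A + 4 * (K * D) →
      |t| ≤ 3 * A + 4 * (K * D) → |F0 z s - F0 z t| ≤ C₀ * |s - t|)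
    (hd : 0 < d) (hball : closedBall x₀ d ⊆ X) (hr : 0 < r) (hrd : 4 * (n + 1) * r ≤ d)
    (hy' : y' ∈ subgrad X u x₀) (hx : x ∈ X) (hxr : ‖x - x₀‖ ≤ r) :
    u x - u x₀ - ⟪y', x - x₀⟫ ≤ 16 * 2 ^ n *
      (8 * ((n * (Λ + B / d) + B / d + C₀) / δ + 1)) ^ (1 / (q - 1)) * r ^ (q / (q - 1)) := by
  have hx₀ : x₀ ∈ X := hball (mem_closedBall_self hd.le)
  obtain ⟨p₁, hp₁⟩ := subgrad_nonempty hX hu.1 hx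
  have hy'Y := hu.2.1 x₀ hx₀ hy'
  have hp₁Y := hu.2.1 x hx hp₁
  set h := u x - u x₀ - ⟪y', x - x₀⟫ with hh
  have hh0 : 0 ≤ h := by linarith [hy' x hx]
  rcases hh0.eq_or_lt with h0 | hpos
  · rw [← h0]; positivity
  set p : EuclideanSpace ℝ (Fin n) := (1 / 2 : ℝ) • y' + (1 / 2 : ℝ) • p₁ with hp
  have hpY : p ∈ closure Y :=
    hYc.closure hy'Y hp₁Y (by norm_num) (by norm_num) (by norm_num)
  set b : ℝ := u x₀ + h - ⟪p, x₀⟫ with hb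
  have hℓ : ∀ z, ⟪p, z⟫ + b = u x₀ + h + 1 / 2 * ⟪y', z - x₀⟫ + 1 / 2 * ⟪p₁, z - x₀⟫ := by
    intro z
    have : ⟪p, z - x₀⟫ = 1 / 2 * ⟪y', z - x₀⟫ + 1 / 2 * ⟪p₁, z - x₀⟫ := by
      rw [hp, inner_add_left, real_inner_smul_left, real_inner_smul_left]
    rw [hb]
    rw [inner_sub_right] at this
    linarith
  have hm : h ≤ ⟪p₁ - y', x - x₀⟫ := by
    have h1 := hp₁ x₀ hx₀
    rw [← neg_sub x x₀, inner_neg_right] at h1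
    rw [inner_sub_left]
    linarith
  have hξ : 0 < ‖p₁ - y'‖ := by
    refine norm_pos_iff.2 fun h0 => ?_
    rw [h0, inner_zero_left] at hm
    linarith
  have hmr : ⟪p₁ - y', x - x₀⟫ ≤ ‖p₁ - y'‖ * r :=
    (real_inner_le_norm _ _).trans (by gcongr)
  have hv := admissible_sup_affine hX hYc hu hpY b
  have huK := lipschitzOnWith_of_subgrad_subset hX hu.1 hu.2.1 hK
  have hvK := lipschitzOnWith_of_subgrad_subset hX hv.1 hv.2.1 hK
  have hwK : LipschitzOnWith (K + K) (fun z => max (u z) (⟪p, z⟫ + b) - u z) X := hvK.sub huK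
  have hw : ∀ z ∈ X, 0 ≤ max (u z) (⟪p, z⟫ + b) - u z := fun z _ =>
    sub_nonneg.2 (le_max_left _ _)
  have hℓ₀ : ⟪p, x₀⟫ + b = u x₀ + h := by rw [hb]; ring
  have hrad := ae_inner_gradient_sup_affine_sub_le (x₀ := x₀) (b := b) hX hu.1 huK hvK hx₀
    (by rw [hℓ₀]; linarith)
  have hinner : ∀ y ∈ closure Y, ∀ z ∈ X, |⟪y, z - x₀⟫| ≤ 2 * (K * D) := by
    intro y hy z hz
    calc |⟪y, z - x₀⟫| ≤ ‖y‖ * ‖z - x₀‖ := abs_real_inner_le_norm _ _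
      _ ≤ K * (‖z‖ + ‖x₀‖) := by gcongr; exacts [hK y hy, norm_sub_le _ _]
      _ ≤ K * (D + D) := by gcongr; exacts [hD z hz, hD x₀ hx₀]
      _ = 2 * (K * D) := by ring
  have hKD : 0 ≤ K * D := mul_nonneg K.2 ((norm_nonneg _).trans (hD x₀ hx₀))
  have hA0 : 0 ≤ A := (abs_nonneg _).trans (hA x₀ hx₀)
  have hF0w : ∀ z ∈ X, F0 z (max (u z) (⟪p, z⟫ + b)) - F0 z (u z) ≤
      C₀ * (max (u z) (⟪p, z⟫ + b) - u z) := by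
    intro z hz
    have huz := abs_le.1 (hA z hz)
    have hux := abs_le.1 (hA x hx)
    have hux₀ := abs_le.1 (hA x₀ hx₀)
    have h1 := abs_le.1 (hinner y' hy'Y z hz)
    have h2 := abs_le.1 (hinner p₁ hp₁Y z hz)
    have h3 := abs_le.1 (hinner y' hy'Y x hx)
    have h4 := hℓ z
    have h5 := hF0C z hz (max (u z) (⟪p, z⟫ + b)) (u z)
      (abs_le.2 ⟨le_max_of_le_left (by linarith), max_le (by linarith) (by linarith)⟩)
      (abs_le.2 ⟨by linarith, by linarith⟩)
    rw [abs_of_nonneg (hw z hz)] at h5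
    exact (le_abs_self _).trans h5
  have hgrad := (contDiff_gradient_uncurry hF1).continuous
  have hVc : Continuous fun z => gradient (F1 z) p :=
    hgrad.comp (continuous_id.prodMk continuous_const)
  have hVBp : ∀ z ∈ X, ‖gradient (F1 z) p‖ ≤ B := fun z hz => hVB z hz p hpY
  have hE := energy_le_of_minimizer hX hXb hYc hK (zero_lt_one.trans hq) hF1 hF0 H1 hu hmin hpY
    hVBp hF0w
  have hT := setIntegral_inner_gradient_le hX hXb hu.1.1 hd hball hw hwK hrad hVc hB hVBp
    (hVΛ p hpY)
  have hI : 0 ≤ ∫ z in X, (max (u z) (⟪p, z⟫ + b) - u z) :=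
    setIntegral_nonneg hX.measurableSet hw
  have hSopen : IsOpen {z ∈ X | u z < ⟪p, z⟫ + b} := by
    have hc : ContinuousOn (fun z => ⟪p, z⟫ + b - u z) X :=
      ContinuousOn.sub (by fun_prop) huK.continuousOn
    convert hc.isOpen_inter_preimage hX (isOpen_Ioi (a := (0 : ℝ))) using 1
    ext z
    simp
  have hx₀S : x₀ ∈ {z ∈ X | u z < ⟪p, z⟫ + b} := ⟨hx₀, by rw [hℓ₀]; linarith⟩
  have hSX : {z ∈ X | u z < ⟪p, z⟫ + b} ⊆ X := fun z hz => hz.1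
  refine height_le_of_energy_le (e := ‖p₁ - y'‖⁻¹ • (p₁ - y')) hX hXb hu.1.1 hd hball hw hwK hrad
    ?_ hr hrd hSopen.measurableSet hSX ?_ ?_ ?_ hq (by positivity) ?_ ?_
  · rw [norm_smul, norm_inv, norm_norm, inv_mul_cancel₀ hξ.ne']
  · exact ENNReal.toReal_pos (hSopen.measure_pos volume ⟨x₀, hx₀S⟩).ne'
      ((measure_mono hSX).trans_lt hXb.measure_lt_top).ne
  · rintro z ⟨hz, hzS⟩
    have : ⟪p, z⟫ + b ≤ u z := not_lt.1 fun hlt => hzS ⟨hz, hlt⟩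
    rw [max_eq_left this, sub_self]
  · rintro z ⟨hz, hzS⟩
    rw [hℓ z] at hzS
    have h1 := hy' z hz
    have h2 := hp₁ z hz
    have h3 : ⟪p₁, z - x⟫ = ⟪p₁, z - x₀⟫ - ⟪p₁, x - x₀⟫ := by
      rw [← inner_sub_right, sub_sub_sub_cancel_right]
    rw [real_inner_smul_left, abs_mul, abs_of_pos (inv_pos.2 hξ), inv_mul_le_iff₀ hξ]
    have h4 : ⟪p₁ - y', x - x₀⟫ = ⟪p₁, x - x₀⟫ - ⟪y', x - x₀⟫ := inner_sub_left _ _ _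
    rw [abs_le, inner_sub_left]
    constructor <;> linarith
  · refine le_of_mul_le_mul_left (hE.trans ((add_le_add_left hT _).trans ?_)) hδ
    have : δ * (((n * (Λ + B / d) + B / d + C₀) / δ + 1) *
        ∫ z in X, (max (u z) (⟪p, z⟫ + b) - u z)) =
        (n * (Λ + B / d) + B / d) * (∫ z in X, (max (u z) (⟪p, z⟫ + b) - u z)) +
        C₀ * (∫ z in X, (max (u z) (⟪p, z⟫ + b) - u z)) +
        δ * ∫ z in X, (max (u z) (⟪p, z⟫ + b) - u z) := by
      field_simp
    rw [this]
    linarith [mul_nonneg hδ.le hI]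
  · rintro z ⟨hz, hzS⟩
    have h1 := hu.1.2 hx₀ hz (by norm_num : (0 : ℝ) ≤ 1 / 2) (by norm_num : (0 : ℝ) ≤ 1 / 2)
      (by norm_num)
    have h2 : ⟪p, (1 / 2 : ℝ) • x₀ + (1 / 2 : ℝ) • z⟫ = 1 / 2 * ⟪p, x₀⟫ + 1 / 2 * ⟪p, z⟫ := by
      rw [inner_add_right, real_inner_smul_right, real_inner_smul_right]
    have h3 := le_max_right (u ((1 / 2 : ℝ) • x₀ + (1 / 2 : ℝ) • z))
      (⟪p, (1 / 2 : ℝ) • x₀ + (1 / 2 : ℝ) • z⟫ + b)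
    rw [smul_eq_mul, smul_eq_mul] at h1
    rw [h2] at h3 ⊢
    linarith

end Energy

/-- **Pointwise `C^{1,1/(q-1)}` separation from supporting planes** (inequality (2.16)):
under (H1)–(H3), a minimizer `u` of `L` over `U₀` satisfies, on every compact `X' ⊆ X`,
`sup_{B_r(x₀)} |u - u(x₀) - y₀'·(· - x₀)| ≤ C r^{q/(q-1)}` for all `x₀ ∈ X'`,
`y₀' ∈ ∂u(x₀)` and `r < r₀`. -/
theorem pointwise_separation {n : ℕ} (hn : 1 ≤ n)
    (X Y : Set (EuclideanSpace ℝ (Fin n)))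
    (hXo : IsOpen X) (hXb : Bornology.IsBounded X)
    (hYo : IsOpen Y) (hYb : Bornology.IsBounded Y) (hYc : Convex ℝ Y)
    (a₀ : ℝ) (y₀ : EuclideanSpace ℝ (Fin n)) (hy₀ : y₀ ∈ Y)
    (q δ : ℝ) (hq : 1 < q) (hδ : 0 < δ)
    (F1 : EuclideanSpace ℝ (Fin n) → EuclideanSpace ℝ (Fin n) → ℝ)
    (F0 : EuclideanSpace ℝ (Fin n) → ℝ → ℝ)
    (hF1 : ContDiff ℝ 2 (fun z : EuclideanSpace ℝ (Fin n) × EuclideanSpace ℝ (Fin n) =>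
      F1 z.1 z.2))
    (hF0 : ContDiff ℝ 1 (fun z : EuclideanSpace ℝ (Fin n) × ℝ => F0 z.1 z.2))
    (H1 : ∀ x ∈ X, ∀ p₁ ∈ Y, ∀ p₂ ∈ Y,
      F1 x p₁ - F1 x p₂ ≥ ⟪gradient (F1 x) p₂, p₁ - p₂⟫ + δ * ‖p₁ - p₂‖ ^ q)
    (η : ℝ → ℝ) (hη : ∀ K : Set ℝ, IsCompact K → ∃ M : ℝ, ∀ z ∈ K, |η z| ≤ M)
    (H2 : ∀ x ∈ X, ∀ z : ℝ, |deriv (F0 x) z| ≤ η z)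
    (g : EuclideanSpace ℝ (Fin n) → ℝ)
    (hg : ∀ K : Set (EuclideanSpace ℝ (Fin n)), K ⊆ Y → IsCompact K →
      ∃ M : ℝ, ∀ p ∈ K, |g p| ≤ M)
    (H3a : ∀ x ∈ X, ∀ p ∈ Y, ‖gradient (F1 x) p‖ ≤ g p)
    (H3b : ∀ x ∈ X, ∀ p ∈ Y, ∀ i : Fin n,
      |fderiv ℝ (fun x' => ⟪gradient (F1 x') p, EuclideanSpace.single i 1⟫) x
        (EuclideanSpace.single i 1)| ≤ g p)
    (u : EuclideanSpace ℝ (Fin n) → ℝ) (hu : admissible X Y a₀ y₀ u)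
    (hmin : ∀ v, admissible X Y a₀ y₀ v → funcL X F1 F0 u ≤ funcL X F1 F0 v) :
    ∀ X' : Set (EuclideanSpace ℝ (Fin n)), X' ⊆ X → IsCompact X' →
      ∃ C > (0:ℝ), ∃ r₀ > (0:ℝ), ∀ x₀ ∈ X', ∀ y₀' ∈ subgrad X u x₀,
        ∀ r : ℝ, 0 < r → r < r₀ → ∀ x ∈ ball x₀ r ∩ X,
          |u x - u x₀ - ⟪y₀', x - x₀⟫| ≤ C * r ^ (q / (q - 1)) := by
  intro X' hX'X hX'c
  obtain ⟨K', hK'⟩ := hYb.closure.exists_norm_le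
  have hK : ∀ y ∈ closure Y, ‖y‖ ≤ K'.toNNReal := fun y hy => (hK' y hy).trans K'.le_coe_toNNReal
  generalize K'.toNNReal = K at hK
  obtain ⟨D, hD⟩ := hXb.exists_norm_le
  have huK := lipschitzOnWith_of_subgrad_subset hXo hu.1 hu.2.1 hK
  obtain ⟨A, hA⟩ := huK.exists_norm_le hXb
  obtain ⟨d, hd, hdX⟩ := hX'c.exists_cthickening_subset_open hXo hX'X
  have hXcpt : IsCompact (closure X) := hXb.isCompact_closure
  have hYcpt : IsCompact (closure Y) := hYb.isCompact_closure
  have hgrad := contDiff_gradient_uncurry hF1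
  obtain ⟨B, hB⟩ := (hXcpt.prod hYcpt).exists_bound_of_continuousOn hgrad.continuous.continuousOn
  obtain ⟨Λ, hΛ⟩ := (hgrad.locallyLipschitz.locallyLipschitzOn
    (s := closure X ×ˢ closure Y)).exists_lipschitzOnWith_of_compact (hXcpt.prod hYcpt)
  obtain ⟨C₀, hC₀⟩ := (hF0.locallyLipschitz.locallyLipschitzOn
    (s := closure X ×ˢ closedBall (0 : ℝ) (3 * A + 4 * (K * D)))).exists_lipschitzOnWith_of_compact
      (hXcpt.prod (isCompact_closedBall _ _))
  refine ⟨16 * 2 ^ n * (8 * ((n * (Λ + max B 0 / d) + max B 0 / d + C₀) / δ + 1)) ^ (1 / (q - 1)),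
    by positivity, d / (4 * (n + 1)), by positivity, ?_⟩
  rintro x₀ hx₀ y' hy' r hr hrd x ⟨hxr, hx⟩
  rw [abs_of_nonneg (by linarith [hy' x hx])]
  refine separation_le_of_energy_constants hXo hXb hYc hK hD hA hq hδ hF1 hF0.continuous H1 hu hmin
    (le_max_right B 0) ?_ ?_ C₀.2 ?_ hd ((closedBall_subset_cthickening hx₀ d).trans hdX) hr ?_ hy'
    hx (mem_ball_iff_norm.1 hxr).le
  · exact fun z hz p hp => (hB (z, p) ⟨subset_closure hz, hp⟩).trans (le_max_left _ _)
  · refine fun p hp => LipschitzOnWith.of_dist_le_mul fun z₁ hz₁ z₂ hz₂ => ?_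
    simpa [Prod.dist_eq] using
      hΛ.dist_le_mul (z₁, p) ⟨subset_closure hz₁, hp⟩ (z₂, p) ⟨subset_closure hz₂, hp⟩
  · intro z hz s t hs ht
    simpa [Prod.dist_eq, Real.dist_eq] using
      hC₀.dist_le_mul (z, s) ⟨subset_closure hz, by simpa using hs⟩ (z, t)
        ⟨subset_closure hz, by simpa using ht⟩
  · rw [lt_div_iff₀ (by positivity)] at hrd
    linarith
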